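/- Let λ ≥ 1 be an integer, let G be a finite simple graph with n vertices and minimum degree δ, and let C be a longest cycle in G with C not a Hamilton cycle. If δ ≥ (n+2)/(λ+1) + λ − 2, then (λ − c̄)(δ − λ − c̄ + 1) ≥ 1, where c̄ is the length of a longest cycle in the subgraph of G induced by the vertices not on C. -/

import Mathlib

open SimpleGraph

/-- A cycle `C` is a longest cycle in `G` if no cycle of `G` has greater length. -/
def IsLongestCycle {V : Type*} (G : SimpleGraph V) {v : V} (C : G.Walk v v) : Prop :=
  C.IsCycle ∧ ∀ (u : V) (D : G.Walk u u), D.IsCycle → D.length ≤ C.length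

open scoped Classical in
/-- The length of a longest path in `H`, with the convention that it is `-1`
when `H` has no vertices. -/
noncomputable def pbar {W : Type*} (H : SimpleGraph W) : ℤ :=
  if Nonempty W then
    ((sSup {n : ℕ | ∃ (u v : W) (p : H.Walk u v), p.IsPath ∧ p.length = n} : ℕ) : ℤ)
  else -1

/-- The length of a longest cycle in `H`, where a single vertex counts as a cycle of
length 1 and a single edge as a cycle of length 2, with the convention that it is `0`
when `H` has no vertices. -/
noncomputable def cbar {W : Type*} (H : SimpleGraph W) : ℕ :=
  sSup {n : ℕ | (n = 1 ∧ Nonempty W) ∨ (n = 2 ∧ ∃ u v : W, H.Adj u v) ∨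
    ∃ (v : W) (c : H.Walk v v), c.IsCycle ∧ c.length = n}

/-- `G` is `k`-connected: it has at least `k+1` vertices and remains connected
after the deletion of any set of fewer than `k` vertices. -/
def IsKConnected {V : Type*} [Fintype V] (G : SimpleGraph V) (k : ℕ) : Prop :=
  k + 1 ≤ Fintype.card V ∧
    ∀ S : Finset V, S.card < k → (G.induce ((↑S : Set V)ᶜ)).Connected

/-- `u` lists cyclically the vertices of a closed path of `G` inside `S` (a vertex and an edge being
allowed as degenerate cases), and no closed path of `G` inside `S` has more vertices. -/
structure IsLongestRing {V : Type*} (G : SimpleGraph V) (S : Set V) {c : ℕ} (u : ZMod c → V) :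
    Prop where
  injective : Function.Injective u
  mem (i : ZMod c) : u i ∈ S
  adj (i : ZMod c) : 2 ≤ c → G.Adj (u i) (u (i + 1))
  max (x : V) (t : List V) : (x :: t).Nodup → (∀ y ∈ x :: t, y ∈ S) →
    (x :: (t ++ [x])).IsChain G.Adj → t.length + 1 ≤ c

/-- The list `u i, u (i + 1), …, u (i + k - 1)`. -/
def arc {V : Type*} {c : ℕ} (u : ZMod c → V) : ZMod c → ℕ → List V
  | _, 0 => []
  | i, k + 1 => u i :: arc u (i + 1) k

section Arc

variable {V : Type*} {c : ℕ} (u : ZMod c → V)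

lemma length_arc (i : ZMod c) (k : ℕ) : (arc u i k).length = k := by
  induction k generalizing i with
  | zero => rfl
  | succ k ih => simp [arc, ih]

lemma mem_arc {i : ZMod c} {k : ℕ} {y : V} : y ∈ arc u i k ↔ ∃ m < k, u (i + m) = y := by
  induction k generalizing i with
  | zero => simp [arc]
  | succ k ih =>
    simp only [arc, List.mem_cons, ih]
    constructor
    · rintro (rfl | ⟨m, hm, rfl⟩)
      · exact ⟨0, by omega, by simp⟩
      · exact ⟨m + 1, by omega, by push_cast; ring_nf⟩
    · rintro ⟨_ | m, hm, rfl⟩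
      · simp
      · exact Or.inr ⟨m, by omega, by push_cast; ring_nf⟩

lemma arc_succ_last (i : ZMod c) (k : ℕ) : arc u i (k + 1) = arc u i k ++ [u (i + k)] := by
  induction k generalizing i with
  | zero => simp [arc]
  | succ k ih =>
    rw [arc, ih, arc, List.cons_append]
    push_cast
    ring_nf

lemma nodup_arc (hu : Function.Injective u) (i : ZMod c) {k : ℕ} (hk : k ≤ c) :
    (arc u i k).Nodup := by
  induction k generalizing i with
  | zero => simp [arc]
  | succ k ih =>
    simp only [arc, List.nodup_cons, mem_arc, not_exists, not_and]
    refine ⟨fun m hm h => ?_, ih _ (by omega)⟩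
    have h1 := hu h
    have h2 : ((m + 1 : ℕ) : ZMod c) = 0 := by
      push_cast
      linear_combination h1
    rw [ZMod.natCast_eq_zero_iff] at h2
    exact absurd (Nat.le_of_dvd (by omega) h2) (by omega)

lemma isChain_arc {G : SimpleGraph V} (hadj : ∀ i, 2 ≤ c → G.Adj (u i) (u (i + 1))) (hc : 2 ≤ c)
    (i : ZMod c) (k : ℕ) : (arc u i k).IsChain G.Adj := by
  induction k generalizing i with
  | zero => simp [arc]
  | succ k ih =>
    have := ih (i + 1)
    cases k with
    | zero => simp [arc]
    | succ k => exact List.isChain_cons_cons.2 ⟨hadj i hc, this⟩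

end Arc

lemma natCast_inj_of_lt {c a b : ℕ} (ha : a < c) (hb : b < c) (h : (a : ZMod c) = b) : a = b := by
  rw [ZMod.natCast_eq_natCast_iff'] at h
  rwa [Nat.mod_eq_of_lt ha, Nat.mod_eq_of_lt hb] at h

lemma isChain_reverse_of_isChain {V : Type*} {G : SimpleGraph V} {l : List V}
    (h : l.IsChain G.Adj) : l.reverse.IsChain G.Adj := by
  rw [List.isChain_reverse]
  exact h.imp fun _ _ h => h.symm

lemma isChain_concat {V : Type*} {G : SimpleGraph V} {x y : V} {l : List V}
    (h : (x :: l).IsChain G.Adj) (hy : G.Adj ((x :: l).getLast (List.cons_ne_nil _ _)) y) :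
    (x :: (l ++ [y])).IsChain G.Adj := by
  rw [← List.cons_append, List.isChain_append]
  refine ⟨h, by simp, fun a ha b hb => ?_⟩
  rw [List.getLast?_eq_some_getLast (List.cons_ne_nil _ _)] at ha
  simp at ha hb
  subst hb
  rw [← ha]
  exact hy

/-- An ear attached to a longest ring is no longer than the segment it bypasses. -/
lemma IsLongestRing.ear {V : Type*} {G : SimpleGraph V} {S : Set V} {c : ℕ} {u : ZMod c → V}
    (h : IsLongestRing G S u) {i : ZMod c} {d : ℕ} (hd : 1 ≤ d) (hdc : d ≤ c) {p : List V}
    (hp : (u i :: (p ++ [u (i + d)])).IsChain G.Adj) (hn : p.Nodup) (hS : ∀ y ∈ p, y ∈ S)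
    (hdis : ∀ y ∈ p, ∀ k, u k ≠ y) : p.length + 1 ≤ d := by
  obtain ⟨e, rfl⟩ := Nat.exists_eq_add_of_le hdc
  have hclose : i + (d : ZMod (d + e)) + (e : ZMod (d + e)) = i := by
    have := ZMod.natCast_self (d + e)
    push_cast at this
    linear_combination this
  have key := h.max (u i) (p ++ arc u (i + d) e) ?_ ?_ ?_
  · simp [length_arc] at key
    omega
  · rw [List.nodup_cons, List.nodup_append]
    refine ⟨?_, hn, nodup_arc u h.injective _ (by omega), ?_⟩
    · rw [List.mem_append, not_or]
      refine ⟨fun hi => hdis _ hi _ rfl, fun hi => ?_⟩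
      obtain ⟨m, hm, hm'⟩ := (mem_arc u).1 hi
      have h2 : ((d + m : ℕ) : ZMod (d + e)) = 0 := by
        have := h.injective hm'
        push_cast
        linear_combination this
      rw [ZMod.natCast_eq_zero_iff] at h2
      exact absurd (Nat.le_of_dvd (by omega) h2) (by omega)
    · rintro a ha _ hb rfl
      obtain ⟨m, hm, hm'⟩ := (mem_arc u).1 hb
      exact hdis _ ha _ hm'
  · intro y hy
    rw [List.mem_cons, List.mem_append] at hy
    rcases hy with rfl | hy | hy
    · exact h.mem _
    · exact hS _ hy
    · obtain ⟨m, hm, rfl⟩ := (mem_arc u).1 hy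
      exact h.mem _
  · have harc : arc u (i + d) e ++ [u i] = arc u (i + d) (e + 1) := by
      rw [arc_succ_last, hclose]
    rw [List.append_assoc, harc, arc, List.isChain_cons_split]
    refine ⟨hp, ?_⟩
    rcases Nat.eq_zero_or_pos e with rfl | he
    · simp [arc]
    · exact isChain_arc u h.adj (by omega) _ (e + 1)

/-- A family of pairwise disjoint paths `u i :: Q i` leaving the ring `u` inside `S`. -/
structure IsExtension {V : Type*} (G : SimpleGraph V) (S : Set V) {c : ℕ} (u : ZMod c → V)
    (Q : ZMod c → List V) : Prop where
  chain (i : ZMod c) : (u i :: Q i).IsChain G.Adj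
  nodup (i : ZMod c) : (Q i).Nodup
  mem {i : ZMod c} {y : V} : y ∈ Q i → y ∈ S
  off {i : ZMod c} {y : V} : y ∈ Q i → ∀ k, u k ≠ y
  eq_of_mem {i j : ZMod c} {y : V} : y ∈ Q i → y ∈ Q j → i = j

/-- The end vertex of the `i`-th path of an extension. -/
def tip {V : Type*} {c : ℕ} (u : ZMod c → V) (Q : ZMod c → List V) (i : ZMod c) : V :=
  (u i :: Q i).getLast (List.cons_ne_nil _ _)

section Extension

variable {V : Type*} {G : SimpleGraph V} {S : Set V} {c : ℕ} {u : ZMod c → V}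
  {Q : ZMod c → List V}

lemma tip_eq_of_nil {i : ZMod c} (h : Q i = []) : tip u Q i = u i := by
  simp [tip, h]

lemma tip_mem_of_ne_nil {i : ZMod c} (h : Q i ≠ []) : tip u Q i ∈ Q i := by
  rw [tip, List.getLast_cons h]
  exact List.getLast_mem h

lemma dropLast_append_tip {i : ZMod c} (h : Q i ≠ []) : (Q i).dropLast ++ [tip u Q i] = Q i := by
  rw [tip, List.getLast_cons h]
  exact List.dropLast_append_getLast h

lemma tip_mem (hu : IsLongestRing G S u) (hQ : IsExtension G S u Q) (i : ZMod c) :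
    tip u Q i ∈ S := by
  by_cases h : Q i = []
  · rw [tip_eq_of_nil h]
    exact hu.mem i
  · exact hQ.mem (tip_mem_of_ne_nil h)

/-- Two end vertices are joined by a path along the ring. -/
lemma IsExtension.exists_path [NeZero c] (hu : IsLongestRing G S u) (hQ : IsExtension G S u Q)
    {i j : ZMod c} (hij : i ≠ j) {x y : V} (hx : G.Adj (tip u Q i) x) (hy : G.Adj (tip u Q j) y) :
    ∃ p : List V, p.Nodup ∧ (∀ z ∈ p, z ∈ S) ∧ (x :: (p ++ [y])).IsChain G.Adj ∧
      p.length = (Q i).length + (Q j).length + (j - i).val + 1 := by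
  have hlt := ZMod.val_lt (j - i)
  have hc : 2 ≤ c := by
    by_contra hc
    have : (j - i).val = 0 := by omega
    rw [ZMod.val_eq_zero, sub_eq_zero] at this
    exact hij this.symm
  have hj : i + ((j - i).val : ZMod c) = j := by
    rw [ZMod.natCast_zmod_val]
    ring
  generalize (j - i).val = e at *
  refine ⟨(Q i).reverse ++ (arc u i (e + 1) ++ Q j), ?_, ?_, ?_, ?_⟩
  · rw [List.nodup_append, List.nodup_append]
    refine ⟨List.nodup_reverse.2 (hQ.nodup i), ⟨nodup_arc u hu.injective _ (by omega), hQ.nodup j,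
      ?_⟩, ?_⟩
    · rintro a ha _ hb rfl
      obtain ⟨m, -, hm⟩ := (mem_arc u).1 ha
      exact hQ.off hb _ hm
    · rintro a ha _ hb rfl
      rw [List.mem_reverse] at ha
      rcases List.mem_append.1 hb with hb | hb
      · obtain ⟨m, -, hm⟩ := (mem_arc u).1 hb
        exact hQ.off ha _ hm
      · exact hij (hQ.eq_of_mem ha hb)
  · intro z hz
    simp only [List.mem_append, List.mem_reverse] at hz
    rcases hz with hz | hz | hz
    · exact hQ.mem hz
    · obtain ⟨m, -, rfl⟩ := (mem_arc u).1 hz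
      exact hu.mem _
    · exact hQ.mem hz
  · have h1 : (x :: ((Q i).reverse ++ [u i])).IsChain G.Adj := by
      have := isChain_reverse_of_isChain (isChain_concat (hQ.chain i) hx)
      simpa using this
    have h2 : (arc u i (e + 1)).IsChain G.Adj := isChain_arc u hu.adj hc _ _
    have h3 : (u j :: (Q j ++ [y])).IsChain G.Adj := isChain_concat (hQ.chain j) hy
    have h4 : (arc u i (e + 1) ++ (Q j ++ [y])).IsChain G.Adj := by
      rw [arc_succ_last, hj] at h2 ⊢
      rw [List.append_assoc, List.singleton_append, List.isChain_split]
      exact ⟨h2, h3⟩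
    simp only [List.append_assoc]
    rw [arc, List.cons_append] at h4 ⊢
    rw [List.isChain_cons_split]
    exact ⟨h1, h4⟩
  · simp [length_arc]
    ring

end Extension

section MaximalExtension

variable {V : Type*} {G : SimpleGraph V} {S : Set V} {c : ℕ} {u : ZMod c → V}
  {Q : ZMod c → List V}

/-- The total length of the paths of an extension plus the number of its nontrivial paths. -/
def weight {V : Type*} {c : ℕ} [NeZero c] (Q : ZMod c → List V) : ℕ :=
  ∑ i, if Q i = [] then 0 else (Q i).length + 1

/-- An extension of maximal weight. -/
structure IsMaximalExtension [NeZero c] (G : SimpleGraph V) (S : Set V) (u : ZMod c → V)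
    (Q : ZMod c → List V) : Prop extends IsExtension G S u Q where
  weight_le (Q' : ZMod c → List V) : IsExtension G S u Q' → weight Q' ≤ weight Q

lemma exists_isMaximalExtension [Fintype V] [NeZero c] (G : SimpleGraph V) (S : Set V)
    (u : ZMod c → V) : ∃ Q, IsMaximalExtension G S u Q := by
  classical
  set W := {n | ∃ Q : ZMod c → List V, IsExtension G S u Q ∧ weight Q = n}
  have hne : W.Nonempty := by
    refine ⟨_, fun _ => [], ⟨?_, ?_, ?_, ?_, ?_⟩, rfl⟩ <;> simp
  have hbdd : BddAbove W := by
    refine ⟨∑ i : ZMod c, (Fintype.card V + 1), ?_⟩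
    rintro _ ⟨Q, hQ, rfl⟩
    refine Finset.sum_le_sum fun i _ => ?_
    have := (hQ.nodup i).length_le_card
    split_ifs <;> omega
  obtain ⟨Q, hQ, hw⟩ := Nat.sSup_mem hne hbdd
  exact ⟨Q, hQ, fun Q' hQ' => hw ▸ le_csSup hbdd ⟨Q', hQ', rfl⟩⟩

variable [NeZero c]

/-- Every neighbour in `S` of an end vertex of a maximal extension lies on the extension. -/
lemma IsMaximalExtension.mem_of_adj_tip (hQ : IsMaximalExtension G S u Q) {i : ZMod c} {y : V}
    (hy : G.Adj (tip u Q i) y) (hyS : y ∈ S) : (∃ k, u k = y) ∨ ∃ l, y ∈ Q l := by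
  classical
  by_contra! hcon
  obtain ⟨hoff, hnot⟩ := hcon
  have hmem : ∀ {k z}, z ∈ Function.update Q i (Q i ++ [y]) k → z ∈ Q k ∨ (k = i ∧ z = y) := by
    intro k z hz
    by_cases hk : k = i
    · subst hk
      simpa using hz
    · rw [Function.update_of_ne hk] at hz
      exact Or.inl hz
  have hext : IsExtension G S u (Function.update Q i (Q i ++ [y])) := by
    refine ⟨fun k => ?_, fun k => ?_, fun {k z} hz => ?_, fun {k z} hz => ?_,
      fun {k l z} hk hl => ?_⟩
    · by_cases hk : k = i
      · subst hk
        rw [Function.update_self]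
        exact isChain_concat (hQ.chain k) hy
      · rw [Function.update_of_ne hk]
        exact hQ.chain k
    · by_cases hk : k = i
      · subst hk
        rw [Function.update_self, List.nodup_append]
        refine ⟨hQ.nodup k, by simp, ?_⟩
        rintro a ha b hb rfl
        rw [List.mem_singleton] at hb
        exact hnot k (hb ▸ ha)
      · rw [Function.update_of_ne hk]
        exact hQ.nodup k
    · rcases hmem hz with h | ⟨-, rfl⟩
      · exact hQ.mem h
      · exact hyS
    · rcases hmem hz with h | ⟨-, rfl⟩
      · exact hQ.off h
      · exact hoff
    · rcases hmem hk with h | ⟨rfl, rfl⟩ <;> rcases hmem hl with h' | ⟨rfl, h'⟩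
      · exact hQ.eq_of_mem h h'
      · exact absurd (h' ▸ h) (hnot _)
      · exact absurd h' (hnot _)
      · rfl
  refine absurd (hQ.weight_le _ hext) (not_le.2 ?_)
  refine Finset.sum_lt_sum (fun k _ => ?_) ⟨i, Finset.mem_univ _, ?_⟩
  · by_cases hk : k = i
    · subst hk
      simp
      split_ifs <;> omega
    · rw [Function.update_of_ne hk]
  · simp
    split_ifs <;> omega

/-- In a maximal extension a trivial end vertex sees only the first vertices of the paths. -/
lemma IsMaximalExtension.eq_cons_of_adj (hQ : IsMaximalExtension G S u Q) {i l : ZMod c} {y : V}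
    (hi : Q i = []) (hy : G.Adj (u i) y) (hl : y ∈ Q l) : ∃ t, Q l = y :: t := by
  classical
  obtain ⟨p, t, hp⟩ := List.append_of_mem hl
  by_cases hpe : p = []
  · exact ⟨t, by simpa [hpe] using hp⟩
  exfalso
  have hil : i ≠ l := by
    rintro rfl
    simp [hi] at hl
  set Q' := Function.update (Function.update Q l p) i (y :: t) with hQ'
  have hQi : Q' i = y :: t := by simp [hQ']
  have hQl : Q' l = p := by simp [hQ', hil.symm]
  have hQo : ∀ k, k ≠ i → k ≠ l → Q' k = Q k := fun k h1 h2 => by simp [hQ', h1, h2]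
  have hnd := hQ.nodup l
  rw [hp, List.nodup_append] at hnd
  have hmem : ∀ {k z}, z ∈ Q' k → (k = i ∧ z ∈ y :: t) ∨ (k = l ∧ z ∈ p) ∨
      (k ≠ i ∧ k ≠ l ∧ z ∈ Q k) := by
    intro k z hz
    by_cases hk : k = i
    · exact Or.inl ⟨hk, by rwa [hk, hQi] at hz⟩
    by_cases hk' : k = l
    · exact Or.inr (Or.inl ⟨hk', by rwa [hk', hQl] at hz⟩)
    · exact Or.inr (Or.inr ⟨hk, hk', by rwa [hQo k hk hk'] at hz⟩)
  have hmem' : ∀ {k z}, z ∈ Q' k → ∃ k', z ∈ Q k' := by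
    intro k z hz
    rcases hmem hz with ⟨-, h⟩ | ⟨-, h⟩ | ⟨-, -, h⟩
    · exact ⟨l, by rw [hp]; exact List.mem_append_right _ h⟩
    · exact ⟨l, by rw [hp]; exact List.mem_append_left _ h⟩
    · exact ⟨k, h⟩
  have hchain := hQ.chain l
  rw [hp, List.isChain_cons_split] at hchain
  have hext : IsExtension G S u Q' := by
    refine ⟨fun k => ?_, fun k => ?_, fun {k z} hz => ?_, fun {k z} hz => ?_,
      fun {k m z} hk hm => ?_⟩
    · by_cases hk : k = i
      · rw [hk, hQi]
        exact List.isChain_cons_cons.2 ⟨hy, hchain.2⟩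
      by_cases hk' : k = l
      · rw [hk', hQl]
        exact (List.isChain_append.1 (List.cons_append ▸ hchain.1)).1
      · rw [hQo k hk hk']
        exact hQ.chain k
    · by_cases hk : k = i
      · rw [hk, hQi]
        exact hnd.2.1
      by_cases hk' : k = l
      · rw [hk', hQl]
        exact hnd.1
      · rw [hQo k hk hk']
        exact hQ.nodup k
    · obtain ⟨k', h⟩ := hmem' hz
      exact hQ.mem h
    · obtain ⟨k', h⟩ := hmem' hz
      exact hQ.off h
    · have hsub1 : ∀ {z}, z ∈ y :: t → z ∈ Q l := fun h => by
        rw [hp]; exact List.mem_append_right _ h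
      have hsub2 : ∀ {z}, z ∈ p → z ∈ Q l := fun h => by
        rw [hp]; exact List.mem_append_left _ h
      rcases hmem hk with ⟨rfl, h⟩ | ⟨rfl, h⟩ | ⟨h1, h2, h⟩ <;>
        rcases hmem hm with ⟨rfl, h'⟩ | ⟨rfl, h'⟩ | ⟨h1', h2', h'⟩
      · rfl
      · exact absurd rfl (hnd.2.2 _ h' _ h)
      · exact absurd (hQ.eq_of_mem (hsub1 h) h').symm h2'
      · exact absurd rfl (hnd.2.2 _ h _ h')
      · rfl
      · exact absurd (hQ.eq_of_mem (hsub2 h) h').symm h2'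
      · exact absurd (hQ.eq_of_mem h (hsub1 h')) h2
      · exact absurd (hQ.eq_of_mem h (hsub2 h')) h2
      · exact hQ.eq_of_mem h h'
  refine absurd (hQ.weight_le _ hext) (not_le.2 ?_)
  have hl' : l ∈ Finset.univ.erase i := by simp [hil.symm]
  have hsplit : ∀ P : ZMod c → List V, weight P = (if P i = [] then 0 else (P i).length + 1) +
      ((if P l = [] then 0 else (P l).length + 1) + ∑ k ∈ (Finset.univ.erase i).erase l,
        if P k = [] then 0 else (P k).length + 1) := by
    intro P
    rw [weight, Finset.add_sum_erase _ (fun k => if P k = [] then 0 else (P k).length + 1) hl',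
      Finset.add_sum_erase _ (fun k => if P k = [] then 0 else (P k).length + 1)
        (Finset.mem_univ _)]
  have hrest : (∑ k ∈ (Finset.univ.erase i).erase l,
      if Q' k = [] then 0 else (Q' k).length + 1) = ∑ k ∈ (Finset.univ.erase i).erase l,
      if Q k = [] then 0 else (Q k).length + 1 := by
    refine Finset.sum_congr rfl fun k hk => ?_
    simp only [Finset.mem_erase] at hk
    rw [hQo k hk.2.1 hk.1]
  rw [hsplit Q, hsplit Q', hrest, hQi, hQl, hi, hp]
  simp [hpe]
  omega

/-- The nontrivial paths whose first vertex is adjacent to the trivial end vertex `u i`. -/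
noncomputable def feet (G : SimpleGraph V) (u : ZMod c → V) (Q : ZMod c → List V) (i : ZMod c) :
    Finset (ZMod c) :=
  open scoped Classical in
  Finset.univ.filter fun l => Q i = [] ∧ ∃ y t, Q l = y :: t ∧ G.Adj (u i) y

omit [NeZero c] in
lemma two_le_of_ne_nil (hu : IsLongestRing G S u) (hQ : IsExtension G S u Q) {j : ZMod c}
    (hj : Q j ≠ []) : 2 ≤ c := by
  obtain ⟨y, t, hy⟩ := List.exists_cons_of_ne_nil hj
  have hyj : y ∈ Q j := by simp [hy]
  have hadj : G.Adj (u j) y := by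
    have := hQ.chain j
    rw [hy] at this
    exact this.rel
  have := hu.max (u j) [y] ?_ ?_ ?_
  · simpa using this
  · simpa using hQ.off hyj j
  · simpa using ⟨hu.mem j, hQ.mem hyj⟩
  · simp [hadj, hadj.symm]

lemma mem_feet {i j : ZMod c} :
    j ∈ feet G u Q i ↔ Q i = [] ∧ ∃ y t, Q j = y :: t ∧ G.Adj (u i) y := by
  simp [feet]

/-- The indices of ring vertices adjacent to the first vertex of a given path are pairwise
nonconsecutive. -/
lemma two_mul_card_feet_le (hu : IsLongestRing G S u)
    (hQ : IsExtension G S u Q) {j : ZMod c}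
    (hj : Q j ≠ []) : 2 * ((Finset.univ.filter fun i => j ∈ feet G u Q i).card + 1) ≤ c := by
  have hc := two_le_of_ne_nil hu hQ hj
  obtain ⟨y, t, hy⟩ := List.exists_cons_of_ne_nil hj
  have hyj : y ∈ Q j := by simp [hy]
  have hadj : G.Adj (u j) y := by
    have := hQ.chain j
    rw [hy] at this
    exact this.rel
  have hjn : j ∉ Finset.univ.filter fun i => j ∈ feet G u Q i := by
    simp [mem_feet, hj]
  rw [← Finset.card_insert_of_notMem hjn]
  set B := insert j (Finset.univ.filter fun i => j ∈ feet G u Q i) with hB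
  have hBadj : ∀ i ∈ B, G.Adj (u i) y := by
    intro i hi
    rw [hB, Finset.mem_insert, Finset.mem_filter, mem_feet] at hi
    rcases hi with rfl | ⟨-, -, y', t', h, h'⟩
    · exact hadj
    · rw [hy, List.cons.injEq] at h
      rwa [h.1]
  have hdisj : Disjoint B (B.map (addRightEmbedding 1)) := by
    rw [Finset.disjoint_left]
    intro i hi hi'
    obtain ⟨k, hk, rfl⟩ := Finset.mem_map.1 hi'
    have := hu.ear (i := k) (d := 1) (p := [y]) le_rfl (by omega) ?_ (by simp)
      (by simpa using hQ.mem hyj) (by simpa using hQ.off hyj)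
    · simp at this
    · have h1 := hBadj _ hk
      have h2 := (hBadj _ hi).symm
      simp only [addRightEmbedding_apply] at h2
      simp [h1, h2]
  have := Finset.card_le_univ (B ∪ B.map (addRightEmbedding 1))
  rw [Finset.card_union_of_disjoint hdisj, Finset.card_map, ZMod.card] at this
  omega

/-- The neighbours in `S` of a trivial end vertex. -/
lemma IsMaximalExtension.card_le_of_eq_nil (hQ : IsMaximalExtension G S u Q) {i : ZMod c}
    (hi : Q i = []) {Y : Finset V} (hY : ∀ y ∈ Y, G.Adj (tip u Q i) y ∧ y ∈ S) :
    Y.card + 1 ≤ c + (feet G u Q i).card := by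
  classical
  rw [tip_eq_of_nil hi] at hY
  have hsub : Y ⊆ (Finset.univ.erase i).image u ∪
      (feet G u Q i).image fun l => (Q l).headD (u l) := by
    intro y hy
    obtain ⟨hadj, hyS⟩ := hY y hy
    rw [Finset.mem_union, Finset.mem_image, Finset.mem_image]
    rcases hQ.mem_of_adj_tip (by rwa [tip_eq_of_nil hi]) hyS with ⟨k, rfl⟩ | ⟨l, hl⟩
    · refine Or.inl ⟨k, ?_, rfl⟩
      simp only [Finset.mem_erase, Finset.mem_univ, and_true]
      rintro rfl
      exact hadj.ne rfl
    · obtain ⟨t, ht⟩ := hQ.eq_cons_of_adj hi hadj hl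
      exact Or.inr ⟨l, mem_feet.2 ⟨hi, y, t, ht, hadj⟩, by simp [ht]⟩
  have h1 := (Finset.card_le_card hsub).trans (Finset.card_union_le _ _)
  have h2 := Finset.card_image_le (s := Finset.univ.erase i) (f := u)
  have h3 := Finset.card_image_le (s := feet G u Q i) (f := fun l => (Q l).headD (u l))
  rw [Finset.card_erase_of_mem (Finset.mem_univ _), Finset.card_univ, ZMod.card] at h2
  have := NeZero.pos c
  omega

omit [NeZero c] in
lemma lt_length_of_adj_tip {j : ZMod c} {t : ℕ} {y : V} (hy : G.Adj (tip u Q j) y)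
    (ht : (u j :: Q j)[t]? = some y) : t < (Q j).length := by
  obtain ⟨h, rfl⟩ := List.getElem?_eq_some_iff.1 ht
  rw [List.length_cons] at h
  by_contra hlt
  have : t = (Q j).length := by omega
  subst this
  refine hy.ne ?_
  rw [tip, List.getLast_eq_getElem]
  rfl

omit [NeZero c] in
lemma IsExtension.exists_half_ear (hQ : IsExtension G S u Q) {j l : ZMod c} (hj : Q j ≠ []) {t : ℕ}
    {y : V} (hy : G.Adj (tip u Q j) y) (ht : (u l :: Q l)[t]? = some y) :
    ∃ E : List V, t ≤ E.length ∧ (u l :: (E ++ [tip u Q j])).IsChain G.Adj ∧ E.Nodup ∧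
      (∀ z ∈ E, z ∈ Q l) ∧ tip u Q j ∉ E := by
  by_cases hlj : l = j
  · subst hlj
    have hlt := lt_length_of_adj_tip hy ht
    have hnd := hQ.nodup l
    rw [← dropLast_append_tip (u := u) hj, List.nodup_append] at hnd
    refine ⟨(Q l).dropLast, by rw [List.length_dropLast]; omega, ?_, hnd.1,
      fun z hz => List.mem_of_mem_dropLast hz, fun h => hnd.2.2 _ h _ (by simp) rfl⟩
    rw [dropLast_append_tip hj]
    exact hQ.chain l
  · obtain ⟨h, rfl⟩ := List.getElem?_eq_some_iff.1 ht
    rw [List.length_cons] at h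
    refine ⟨(Q l).take t, by rw [List.length_take]; omega, ?_, (hQ.nodup l).take,
      fun z hz => List.mem_of_mem_take hz, fun hz =>
        hlj (hQ.eq_of_mem (List.mem_of_mem_take hz) (tip_mem_of_ne_nil hj))⟩
    refine isChain_concat ?_ ?_
    · exact (hQ.chain l).take (t + 1)
    · have : (u l :: (Q l).take t).getLast (List.cons_ne_nil _ _) = (u l :: Q l)[t] := by
        have h0 : u l :: (Q l).take t = (u l :: Q l).take (t + 1) := rfl
        rw [List.getLast_eq_getElem]
        simp only [h0, List.getElem_take]
        congr 1
        simp
        omega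
      rw [this]
      exact hy.symm

/-- Two neighbours of an end vertex on different paths force their feet to be far apart. -/
lemma IsExtension.add_le_val (hu : IsLongestRing G S u) (hQ : IsExtension G S u Q)
    {j l m : ZMod c} (hj : Q j ≠ []) (hlm : l ≠ m) {t s : ℕ} {y z : V}
    (hy : G.Adj (tip u Q j) y) (ht : (u l :: Q l)[t]? = some y)
    (hz : G.Adj (tip u Q j) z) (hs : (u m :: Q m)[s]? = some z) :
    t + s + 2 ≤ (m - l).val := by
  obtain ⟨E, hE, hEc, hEn, hEm, hEt⟩ := hQ.exists_half_ear hj hy ht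
  obtain ⟨F, hF, hFc, hFn, hFm, hFt⟩ := hQ.exists_half_ear hj hz hs
  have hval : (m - l).val ≠ 0 := by
    rw [Ne, ZMod.val_eq_zero, sub_eq_zero]
    exact fun h => hlm h.symm
  have hm : l + ((m - l).val : ZMod c) = m := by
    rw [ZMod.natCast_zmod_val]
    ring
  have hmem : ∀ x ∈ E ++ tip u Q j :: F.reverse, ∃ k, x ∈ Q k := by
    intro x hx
    simp only [List.mem_append, List.mem_cons, List.mem_reverse] at hx
    rcases hx with hx | rfl | hx
    · exact ⟨l, hEm x hx⟩
    · exact ⟨j, tip_mem_of_ne_nil hj⟩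
    · exact ⟨m, hFm x hx⟩
  have key := hu.ear (i := l) (d := (m - l).val) (p := E ++ tip u Q j :: F.reverse) (by omega)
    (ZMod.val_lt _).le ?_ ?_ ?_ ?_
  · simp only [List.length_append, List.length_cons, List.length_reverse] at key
    omega
  · rw [hm, List.append_assoc, List.cons_append, List.isChain_cons_split]
    refine ⟨hEc, ?_⟩
    have := isChain_reverse_of_isChain hFc
    simpa using this
  · rw [List.nodup_append, List.nodup_cons, List.nodup_reverse]
    refine ⟨hEn, ⟨by simpa using hFt, hFn⟩, ?_⟩
    rintro a ha b hb rfl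
    rw [List.mem_cons, List.mem_reverse] at hb
    rcases hb with rfl | hb
    · exact hEt ha
    · exact hlm (hQ.eq_of_mem (hEm _ ha) (hFm _ hb))
  · intro x hx
    obtain ⟨k, hk⟩ := hmem x hx
    exact hQ.mem hk
  · intro x hx
    obtain ⟨k, hk⟩ := hmem x hx
    exact hQ.off hk

omit [NeZero c] in
lemma IsExtension.length_le_of_adj_tip (hu : IsLongestRing G S u) (hQ : IsExtension G S u Q)
    {j : ZMod c} {t : ℕ} {y : V} (hy : G.Adj (tip u Q j) y) (ht : (u j :: Q j)[t]? = some y) :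
    (Q j).length + 1 ≤ t + c := by
  obtain ⟨h, rfl⟩ := List.getElem?_eq_some_iff.1 ht
  have hdrop := List.drop_eq_getElem_cons h
  have hnd : (u j :: Q j).Nodup := List.nodup_cons.2 ⟨fun h => hQ.off h j rfl, hQ.nodup j⟩
  have key := hu.max (u j :: Q j)[t] ((u j :: Q j).drop (t + 1)) ?_ ?_ ?_
  · rw [List.length_drop, List.length_cons] at key
    omega
  · rw [← hdrop]
    exact hnd.drop
  · intro z hz
    rw [← hdrop] at hz
    rcases List.mem_cons.1 (List.mem_of_mem_drop hz) with rfl | hz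
    · exact hu.mem j
    · exact hQ.mem hz
  · refine isChain_concat ?_ ?_
    · rw [← hdrop]
      exact (hQ.chain j).drop t
    · simp only [← hdrop, List.getLast_drop]
      exact hy

/-- The neighbours in `S` of a nontrivial end vertex. -/
lemma IsMaximalExtension.card_le_of_ne_nil (hu : IsLongestRing G S u)
    (hQ : IsMaximalExtension G S u Q) {j : ZMod c} (hj : Q j ≠ []) {Y : Finset V}
    (hY : ∀ y ∈ Y, G.Adj (tip u Q j) y ∧ y ∈ S) :
    Y.card + 1 ≤ c ∧ (2 * (Q j).length + 2 < c → 2 * Y.card ≤ c) := by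
  classical
  have hc := two_le_of_ne_nil hu hQ.toIsExtension hj
  have hpos : ∀ y ∈ Y, ∃ l, ∃ t : ℕ, (u l :: Q l)[t]? = some y := by
    intro y hy
    obtain ⟨hadj, hyS⟩ := hY y hy
    rcases hQ.mem_of_adj_tip hadj hyS with ⟨k, rfl⟩ | ⟨l, hl⟩
    · exact ⟨k, 0, rfl⟩
    · exact ⟨l, List.mem_iff_getElem?.1 (List.mem_cons_of_mem _ hl)⟩
  choose! L T hLT using hpos
  by_cases hall : ∀ y ∈ Y, L y = j
  · have hT : ∀ y ∈ Y, (u j :: Q j)[T y]? = some y := fun y hy => by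
      have := hLT y hy
      rwa [hall y hy] at this
    have hinj : Set.InjOn T Y := by
      intro y hy z hz h
      have h1 := hT y hy
      rw [h, hT z hz] at h1
      exact (Option.some.inj h1).symm
    have h1 : Y.card ≤ (Finset.Ico ((Q j).length + 1 - c) (Q j).length).card := by
      refine Finset.card_le_card_of_injOn T (fun y hy => ?_) hinj
      have h1 := lt_length_of_adj_tip (hY y hy).1 (hT y hy)
      have h2 := hQ.length_le_of_adj_tip hu (hY y hy).1 (hT y hy)
      rw [Finset.mem_coe, Finset.mem_Ico]
      omega
    rw [Nat.card_Ico] at h1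
    omega
  · push Not at hall
    obtain ⟨z, hz, hzj⟩ := hall
    have hdist : ∀ y ∈ Y, ∀ y' ∈ Y, L y ≠ L y' → T y + T y' + 2 ≤ (L y' - L y).val :=
      fun y hy y' hy' hne => hQ.add_le_val hu hj hne (hY y hy).1 (hLT y hy) (hY y' hy').1
        (hLT y' hy')
    have hown : ∃ x, ∃ t : ℕ, G.Adj (tip u Q j) x ∧ (u j :: Q j)[t]? = some x := by
      have hch := hQ.chain j
      rw [← dropLast_append_tip (u := u) hj, ← List.cons_append] at hch
      refine ⟨(u j :: (Q j).dropLast).getLast (List.cons_ne_nil _ _), (Q j).length - 1, ?_, ?_⟩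
      · refine ((List.isChain_append.1 hch).2.2 _ ?_ _ (by simp)).symm
        rw [List.getLast?_eq_some_getLast (List.cons_ne_nil _ _)]
        rfl
      · have hlen := List.length_pos_iff.2 hj
        rw [List.getLast_eq_getElem, List.getElem?_eq_some_iff]
        refine ⟨by simp, ?_⟩
        have h0 : u j :: (Q j).dropLast = (u j :: Q j).dropLast := by
          rw [List.dropLast_cons_of_ne_nil hj]
        simp only [h0, List.getElem_dropLast]
        congr 1
        simp
    obtain ⟨x, r, hx, hr⟩ := hown
    have hval : ∀ a b : ZMod c, a ≠ b → (a - b).val + (b - a).val = c := by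
      intro a b hab
      have : NeZero (a - b) := ⟨sub_ne_zero.2 hab⟩
      have h1 := ZMod.val_neg_of_ne_zero (a - b)
      rw [neg_sub] at h1
      have := ZMod.val_lt (a - b)
      omega
    have hTc : ∀ y ∈ Y, 2 * T y + 4 ≤ c := by
      intro y hy
      by_cases h : L y = j
      · have hne : L y ≠ L z := by
          rw [h]
          exact hzj.symm
        have h1 := hdist y hy z hz hne
        have h2 := hdist z hz y hy hne.symm
        have h3 := hval _ _ hne
        omega
      · have h1 := hQ.add_le_val hu hj h (hY y hy).1 (hLT y hy) hx hr
        have h2 := hQ.add_le_val hu hj (Ne.symm h) hx hr (hY y hy).1 (hLT y hy)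
        have h3 := hval _ _ h
        omega
    have hTinj : ∀ y ∈ Y, ∀ y' ∈ Y, L y = L y' → T y = T y' → y = y' := by
      intro y hy y' hy' h h'
      have h1 := hLT y hy
      rw [h, h', hLT y' hy'] at h1
      exact (Option.some.inj h1).symm
    have hne_cast : ∀ a b : ZMod c, ∀ k : ℕ, k < c → k < (b - a).val → b - a ≠ k := by
      intro a b k hk hlt h
      rw [h, ZMod.val_natCast_of_lt hk] at hlt
      exact lt_irrefl _ hlt
    -- two positions with the same value under either map have equal feet
    have hfwd : ∀ y ∈ Y, ∀ y' ∈ Y, T y' ≤ T y → L y + T y = L y' + T y' → y = y' := by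
      intro y hy y' hy' hle h
      have hTy := hTc y hy
      by_cases hL : L y = L y'
      · rw [hL, add_right_inj] at h
        exact hTinj y hy y' hy' hL (natCast_inj_of_lt (by omega) (by omega) h)
      · refine absurd ?_ (hne_cast (L y) (L y') (T y - T y') (by omega) ?_)
        · rw [Nat.cast_sub hle]
          linear_combination -h
        · have := hdist y hy y' hy' hL
          omega
    have hbwd : ∀ y ∈ Y, ∀ y' ∈ Y, T y' ≤ T y → L y - T y - 1 = L y' - T y' - 1 → y = y' := by
      intro y hy y' hy' hle h
      have hTy := hTc y hy
      by_cases hL : L y = L y'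
      · rw [hL] at h
        refine hTinj y hy y' hy' hL (natCast_inj_of_lt (c := c) (by omega) (by omega) ?_)
        linear_combination -h
      · refine absurd ?_ (hne_cast (L y') (L y) (T y - T y') (by omega) ?_)
        · rw [Nat.cast_sub hle]
          linear_combination h
        · have := hdist y' hy' y hy (Ne.symm hL)
          omega
    have hcross : ∀ y ∈ Y, ∀ y' ∈ Y, L y + T y ≠ L y' - T y' - 1 := by
      intro y hy y' hy' h
      have hTy := hTc y hy
      have hTy' := hTc y' hy'
      by_cases hL : L y = L y'
      · have h2 : ((T y + T y' + 1 : ℕ) : ZMod c) = 0 := by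
          push_cast
          rw [hL] at h
          linear_combination h
        rw [ZMod.natCast_eq_zero_iff] at h2
        exact absurd (Nat.le_of_dvd (by omega) h2) (by omega)
      · refine hne_cast (L y) (L y') (T y + T y' + 1) (by omega) ?_ ?_
        · have := hdist y hy y' hy' hL
          omega
        · push_cast
          linear_combination -h
    have hi1 : Set.InjOn (fun y => L y + T y) Y := by
      intro y hy y' hy' h
      rcases le_total (T y') (T y) with hle | hle
      · exact hfwd y hy y' hy' hle h
      · exact (hfwd y' hy' y hy hle h.symm).symm
    have hi2 : Set.InjOn (fun y => L y - T y - 1) Y := by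
      intro y hy y' hy' h
      rcases le_total (T y') (T y) with hle | hle
      · exact hbwd y hy y' hy' hle h
      · exact (hbwd y' hy' y hy hle h.symm).symm
    have hdisj : Disjoint (Y.image fun y => L y + T y) (Y.image fun y => L y - T y - 1) := by
      rw [Finset.disjoint_left]
      intro a ha ha'
      obtain ⟨y, hy, rfl⟩ := Finset.mem_image.1 ha
      obtain ⟨y', hy', h⟩ := Finset.mem_image.1 ha'
      exact hcross y hy y' hy' h.symm
    have := Finset.card_le_univ ((Y.image fun y => L y + T y) ∪ Y.image fun y => L y - T y - 1)
    rw [Finset.card_union_of_disjoint hdisj, Finset.card_image_of_injOn hi1,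
      Finset.card_image_of_injOn hi2, ZMod.card] at this
    omega

end MaximalExtension

/-- The lengths of the segments into which a finite set cuts a cyclic order. -/
lemma exists_gap {N : ℕ} [NeZero N] (s : Finset (ZMod N)) : ∃ g : ZMod N → ℕ,
    (∀ a ∈ s, 1 ≤ g a ∧ g a ≤ N ∧ a + g a ∈ s ∧ ∀ d : ℕ, 1 ≤ d → a + d ∈ s → g a ≤ d) ∧
      ∑ a ∈ s, g a ≤ N := by
  classical
  have hex : ∀ a ∈ s, ∃ d : ℕ, (1 ≤ d ∧ a + d ∈ s) ∧ d ≤ N ∧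
      ∀ e : ℕ, 1 ≤ e → a + e ∈ s → d ≤ e := by
    intro a ha
    have h : ∃ d : ℕ, 1 ≤ d ∧ a + d ∈ s := ⟨N, NeZero.one_le, by simpa using ha⟩
    exact ⟨Nat.find h, Nat.find_spec h, Nat.find_min' h ⟨NeZero.one_le, by simpa using ha⟩,
      fun e h1 h2 => Nat.find_min' h ⟨h1, h2⟩⟩
  choose! g h1 h2 h3 using hex
  refine ⟨g, fun a ha => ⟨(h1 a ha).1, h2 a ha, (h1 a ha).2, h3 a ha⟩, ?_⟩
  have hcard : (Finset.univ : Finset (ZMod N)).card = N := by rw [Finset.card_univ, ZMod.card]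
  have : ∑ a ∈ s, g a = (s.sigma fun a => Finset.range (g a)).card := by
    simp [Finset.card_sigma]
  rw [this]
  refine (Finset.card_le_card_of_injOn (t := Finset.univ) (fun p => p.1 + (p.2 : ZMod N))
    (by simp) ?_).trans hcard.le
  have key : ∀ a ∈ s, ∀ b ∈ s, ∀ k l : ℕ, k ≤ l → l < g b → a + (k : ZMod N) = b + l →
      a = b ∧ k = l := by
    intro a ha b hb k l hkl hl h
    have hab : a = b + ((l - k : ℕ) : ZMod N) := by
      rw [Nat.cast_sub hkl]
      linear_combination h
    rcases Nat.eq_or_lt_of_le hkl with rfl | hlt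
    · simpa using hab
    · have := h3 b hb (l - k) (by omega) (hab ▸ ha)
      omega
  rintro ⟨a, k⟩ hp ⟨b, l⟩ hq h
  simp only [Finset.coe_sigma, Set.mem_sigma_iff, Finset.mem_coe, Finset.mem_range] at hp hq
  rcases le_total k l with hkl | hkl
  · obtain ⟨rfl, rfl⟩ := key a hp.1 b hq.1 k l hkl hq.2 h
    rfl
  · obtain ⟨rfl, rfl⟩ := key b hq.1 a hp.1 l k hkl hp.2 h.symm
    rfl

/-- Going around a cyclic order, a nonconstant predicate fails somewhere just after it holds. -/
lemma exists_switch {N : ℕ} [NeZero N] {s : Finset (ZMod N)} {g : ZMod N → ℕ}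
    (hg : ∀ a ∈ s, 1 ≤ g a ∧ g a ≤ N ∧ a + g a ∈ s ∧ ∀ d : ℕ, 1 ≤ d → a + d ∈ s → g a ≤ d)
    (p : ZMod N → Prop) {a b : ZMod N} (ha : a ∈ s) (hb : b ∈ s) (hpa : p a) (hpb : ¬ p b) :
    ∃ x ∈ s, p x ∧ ¬ p (x + g x) := by
  by_contra! hcon
  have key : ∀ d : ℕ, ∀ a ∈ s, p a → a + d ∈ s → p (a + d) := by
    intro d
    induction d using Nat.strong_induction_on with
    | _ d ih =>
      intro a ha hpa hd
      rcases Nat.eq_zero_or_pos d with rfl | hpos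
      · simpa using hpa
      obtain ⟨h1, -, h3, h4⟩ := hg a ha
      have hle := h4 d hpos hd
      have heq : a + (g a : ZMod N) + ((d - g a : ℕ) : ZMod N) = a + d := by
        rw [Nat.cast_sub hle]
        ring
      have := ih (d - g a) (by omega) _ h3 (hcon a ha hpa) (heq ▸ hd)
      rwa [heq] at this
  have heq : a + ((b - a).val : ZMod N) = b := by
    rw [ZMod.natCast_zmod_val]
    ring
  have := key (b - a).val a ha hpa (heq.symm ▸ hb)
  exact hpb (heq ▸ this)

section Counting

variable {V : Type*} {G : SimpleGraph V} {c N : ℕ} [NeZero c] [NeZero N] {z : ZMod N → V}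
  {u : ZMod c → V} {Q : ZMod c → List V}

omit [NeZero N] in
/-- Distinct end vertices attached to both ends of a segment of `z` make it long. -/
lemma IsExtension.le_segment (hz : IsLongestRing G Set.univ z)
    (hu : IsLongestRing G (Set.range z)ᶜ u) (hQ : IsExtension G (Set.range z)ᶜ u Q) {a : ZMod N}
    {d : ℕ} (hd : 1 ≤ d) (hdN : d ≤ N) {i j : ZMod c} (hij : i ≠ j)
    (hi : G.Adj (tip u Q i) (z a)) (hj : G.Adj (tip u Q j) (z (a + d))) :
    (Q i).length + (Q j).length + (j - i).val + 2 ≤ d ∧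
      (Q i).length + (Q j).length + (i - j).val + 2 ≤ d := by
  have hoff : ∀ {y}, y ∈ (Set.range z)ᶜ → ∀ k, z k ≠ y := by
    rintro y hy k rfl
    exact hy ⟨k, rfl⟩
  constructor
  · obtain ⟨p, hn, hS, hch, hlen⟩ := hQ.exists_path hu hij hi hj
    have := hz.ear hd hdN hch hn (fun _ _ => Set.mem_univ _) fun y hy => hoff (hS y hy)
    omega
  · obtain ⟨p, hn, hS, hch, hlen⟩ := hQ.exists_path hu hij.symm hj hi
    have hch' := isChain_reverse_of_isChain hch
    have := hz.ear (i := a) hd hdN (p := p.reverse) (by simpa using hch') (List.nodup_reverse.2 hn)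
      (fun _ _ => Set.mem_univ _) fun y hy => hoff (hS y (List.mem_reverse.1 hy))
    rw [List.length_reverse] at this
    omega

omit [NeZero N] in
/-- A segment of `z` is longer than the number of end vertices attached to its first vertex. -/
lemma IsExtension.card_lt_segment (hz : IsLongestRing G Set.univ z)
    (hu : IsLongestRing G (Set.range z)ᶜ u) (hQ : IsExtension G (Set.range z)ᶜ u Q) {a : ZMod N}
    {d : ℕ} (hd : 1 ≤ d) (hdN : d ≤ N) {A : Finset (ZMod c)} {j : ZMod c}
    (hA : ∀ i ∈ A, G.Adj (tip u Q i) (z a)) (hne : A.Nonempty)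
    (hj : G.Adj (tip u Q j) (z (a + d))) : A.card + 1 ≤ d := by
  classical
  by_cases h : (A.erase j).Nonempty
  · obtain ⟨i, hi, hmax⟩ := Finset.exists_max_image _ (fun i => (j - i).val) h
    rw [Finset.mem_erase] at hi
    have h1 := (hQ.le_segment hz hu hd hdN hi.1 (hA i hi.2) hj).1
    have h2 : A.card ≤ (Finset.range ((j - i).val + 1)).card := by
      refine Finset.card_le_card_of_injOn (fun k => (j - k).val) (fun k hk => ?_) ?_
      · rw [Finset.mem_coe, Finset.mem_range]
        by_cases hkj : k = j
        · simp [hkj]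
        · exact Nat.lt_succ_of_le (hmax k (Finset.mem_erase.2 ⟨hkj, hk⟩))
      · intro k _ l _ h
        simpa using ZMod.val_injective c h
    rw [Finset.card_range] at h2
    omega
  · rw [Finset.not_nonempty_iff_eq_empty, Finset.erase_eq_empty_iff] at h
    obtain rfl : A = {j} := h.resolve_left hne.ne_empty
    have hja := hA j (Finset.mem_singleton_self j)
    have htip := tip_mem hu hQ j
    exact hz.ear (i := a) hd hdN (p := [tip u Q j]) (by simp [hja.symm, hj]) (by simp) (by simp)
      (by simpa using fun k hk => htip ⟨k, hk⟩)

end Counting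

/-- Weighted counting of the attachments `A a` of a finite set of indices to the points `a` of a
cyclic order with gaps `g`. -/
lemma card_mul_add_le_sum_gap {N : ℕ} [NeZero N] {ι : Type*} [Fintype ι] [Nonempty ι]
    [DecidableEq ι] {A : ZMod N → Finset ι} {s : Finset (ZMod N)}
    (hs : ∀ a, a ∈ s ↔ (A a).Nonempty) {g : ZMod N → ℕ}
    (hg : ∀ a ∈ s, 1 ≤ g a ∧ g a ≤ N ∧ a + g a ∈ s ∧ ∀ d : ℕ, 1 ≤ d → a + d ∈ s → g a ≤ d)
    {feet : ι → Finset ι} {nil long : ι → Prop} {r : ℕ}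
    (hfeet : ∀ i, ∀ j ∈ feet i, nil i ∧ ¬ nil j)
    (hlong : ∀ j, ¬ nil j → r ≤ (Finset.univ.filter fun a => j ∈ A a).card)
    (hshort : ∀ j, ¬ nil j → ¬ long j → r + (Finset.univ.filter fun i => j ∈ feet i).card ≤
      (Finset.univ.filter fun a => j ∈ A a).card)
    (hnil : ∀ i, nil i → r ≤ (Finset.univ.filter fun a => i ∈ A a).card + (feet i).card)
    (hother : ∀ j, ¬ nil j → ∃ l, l ≠ j ∧ ∃ a, l ∈ A a)
    (hgap : ∀ a ∈ s, (A a).card + 1 ≤ g a)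
    (hgap' : ∀ a ∈ s, ∀ j ∈ A a, long j → ¬ (A a = {j} ∧ A (a + g a) = {j}) →
      Fintype.card ι + 1 ≤ g a) :
    (Fintype.card ι + 1) * r ≤ ∑ a ∈ s, g a := by
  classical
  set good : ι → ZMod N → Prop := fun j a =>
    j ∈ A a ∧ long j ∧ ¬ (A a = {j} ∧ A (a + g a) = {j}) with hgood
  set A' : ZMod N → Finset ι := fun a =>
    Finset.univ.filter fun i => i ∈ A a ∨ ∃ j ∈ feet i, good j a with hA'
  have hmem_iff : ∀ {i a}, i ∈ A' a ↔ i ∈ A a ∨ ∃ j ∈ feet i, good j a := by simp [hA']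
  have hs_of_mem : ∀ {i a}, i ∈ A' a → a ∈ s := by
    intro i a h
    rw [hs]
    rcases hmem_iff.1 h with h | ⟨j, -, h, -⟩
    · exact ⟨i, h⟩
    · exact ⟨j, h⟩
  have hcard : ∀ a ∈ s, (A' a).card + 1 ≤ g a := by
    intro a ha
    by_cases h : ∃ j, good j a
    · obtain ⟨j, h1, h2, h3⟩ := h
      have := hgap' a ha j h1 h2 h3
      have := Finset.card_le_univ (A' a)
      omega
    · rw [not_exists] at h
      have : A' a = A a := by
        ext i
        rw [hmem_iff]
        simp [h]
      rw [this]
      exact hgap a ha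
  set n : ι → ℕ := fun i => (Finset.univ.filter fun a => i ∈ A' a).card with hn
  set sh : ι → Finset ι := fun i => (feet i).filter fun j => ¬ long j with hsh
  set b : ι → ℕ := fun j => if long j then 0 else (Finset.univ.filter fun i => j ∈ feet i).card
    with hb
  have hmain : ∀ i, r + b i ≤ n i + (sh i).card := by
    intro i
    by_cases hi : nil i
    · have hbi : b i = 0 := by
        simp only [hb]
        split_ifs
        · rfl
        · rw [Finset.card_eq_zero, Finset.filter_eq_empty_iff]
          exact fun k _ hk => (hfeet k i hk).2 hi
      rw [hbi, add_zero]
      by_cases hcase : ∃ j ∈ feet i, long j ∧ ∀ a, j ∈ A a → A a ≠ {j}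
      · obtain ⟨j, hj, hjl, hja⟩ := hcase
        refine ((hlong j (hfeet i j hj).2).trans (Finset.card_le_card fun a ha => ?_)).trans
          (Nat.le_add_right _ _)
        rw [Finset.mem_filter] at ha ⊢
        exact ⟨Finset.mem_univ _, hmem_iff.2 (Or.inr ⟨j, hj, ha.2, hjl, fun h => hja a ha.2 h.1⟩)⟩
      · push Not at hcase
        have hex : ∀ j, j ∈ feet i ∧ long j → ∃ a, A a = {j} ∧ A (a + g a) ≠ {j} := by
          rintro j ⟨hj, hjl⟩
          obtain ⟨a, ha, haj⟩ := hcase j hj hjl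
          obtain ⟨l, hl, a', ha'⟩ := hother j (hfeet i j hj).2
          obtain ⟨x, -, h⟩ := exists_switch hg (fun x => A x = {j}) ((hs a).2 ⟨j, ha⟩)
            ((hs a').2 ⟨l, ha'⟩) haj fun h => hl (by simpa [h] using ha')
          exact ⟨x, h⟩
        choose! f hf1 hf2 using hex
        have hsub : (Finset.univ.filter fun a => i ∈ A a) ∪
            ((feet i).filter long).image f ⊆ Finset.univ.filter fun a => i ∈ A' a := by
          intro a ha
          rw [Finset.mem_filter]
          refine ⟨Finset.mem_univ _, hmem_iff.2 ?_⟩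
          rcases Finset.mem_union.1 ha with ha | ha
          · exact Or.inl (Finset.mem_filter.1 ha).2
          · obtain ⟨j, hj, rfl⟩ := Finset.mem_image.1 ha
            rw [Finset.mem_filter] at hj
            exact Or.inr ⟨j, hj.1, by simp [hf1 j hj], hj.2, fun h => hf2 j hj h.2⟩
        have hdis : Disjoint (Finset.univ.filter fun a => i ∈ A a)
            (((feet i).filter long).image f) := by
          rw [Finset.disjoint_left]
          intro a ha ha'
          obtain ⟨j, hj, rfl⟩ := Finset.mem_image.1 ha'
          rw [Finset.mem_filter] at ha hj
          rw [hf1 j hj, Finset.mem_singleton] at ha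
          exact (hfeet i j hj.1).2 (ha.2 ▸ hi)
        have hinj : (((feet i).filter long).image f).card = ((feet i).filter long).card := by
          refine Finset.card_image_of_injOn fun j hj k hk h => ?_
          rw [Finset.mem_coe, Finset.mem_filter] at hj hk
          have := hf1 j hj
          rw [h, hf1 k hk] at this
          exact (Finset.singleton_inj.1 this).symm
        have h1 := Finset.card_le_card hsub
        rw [Finset.card_union_of_disjoint hdis, hinj] at h1
        have h2 := Finset.card_filter_add_card_filter_not (s := feet i) (p := long)
        have h3 := hnil i hi
        simp only [hn, hsh]
        omega
    · have hle : (Finset.univ.filter fun a => i ∈ A a).card ≤ n i := by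
        refine Finset.card_le_card fun a ha => ?_
        rw [Finset.mem_filter] at ha ⊢
        exact ⟨ha.1, hmem_iff.2 (Or.inl ha.2)⟩
      simp only [hb]
      split_ifs with h
      · have := hlong i hi
        omega
      · have := hshort i hi h
        omega
  have hdouble : ∑ i, b i = ∑ i, (sh i).card := by
    have h1 : ∀ j, b j = ∑ i, if j ∈ sh i then 1 else 0 := by
      intro j
      simp only [hb, hsh, Finset.mem_filter]
      split_ifs with h
      · simp [h]
      · simp [h]
    have h2 : ∀ i, (sh i).card = ∑ j, if j ∈ sh i then 1 else 0 := by
      intro i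
      simp
    simp_rw [h2]
    rw [Finset.sum_comm]
    exact Finset.sum_congr rfl fun j _ => h1 j
  have hcount : ∑ i, n i = ∑ a ∈ s, (A' a).card := by
    have h1 : ∀ i, n i = ∑ a ∈ s, if i ∈ A' a then 1 else 0 := by
      intro i
      rw [← Finset.card_filter]
      refine congrArg Finset.card ?_
      ext a
      simp only [Finset.mem_filter, Finset.mem_univ, true_and]
      exact ⟨fun h => ⟨hs_of_mem h, h⟩, fun h => h.2⟩
    simp_rw [h1]
    rw [Finset.sum_comm]
    simp
  have hs_card : r ≤ s.card := by
    have hle : ∀ i, (Finset.univ.filter fun a => i ∈ A a).card ≤ s.card := by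
      refine fun i => Finset.card_le_card fun a ha => ?_
      rw [Finset.mem_filter] at ha
      exact (hs a).2 ⟨i, ha.2⟩
    by_cases h : ∃ j, ¬ nil j
    · obtain ⟨j, hj⟩ := h
      exact (hlong j hj).trans (hle j)
    · push Not at h
      obtain ⟨i⟩ := ‹Nonempty ι›
      have h0 : feet i = ∅ := Finset.eq_empty_of_forall_notMem fun j hj => (hfeet i j hj).2 (h j)
      have := hnil i (h i)
      rw [h0, Finset.card_empty, add_zero] at this
      exact this.trans (hle i)
  have h1 : ∑ i, (r + b i) ≤ ∑ i, (n i + (sh i).card) := Finset.sum_le_sum fun i _ => hmain i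
  have h2 : ∑ a ∈ s, ((A' a).card + 1) ≤ ∑ a ∈ s, g a := Finset.sum_le_sum hcard
  rw [Finset.sum_add_distrib, Finset.sum_add_distrib, Finset.sum_const, Finset.card_univ,
    smul_eq_mul] at h1
  rw [Finset.sum_add_distrib, Finset.sum_const, smul_eq_mul, mul_one] at h2
  rw [add_mul, one_mul]
  omega

/-- A lower bound for the number `N` of vertices of a longest ring `z` in terms of the minimum
degree and of the number `c` of vertices of a longest ring avoiding `z`. -/
theorem IsLongestRing.mul_le {V : Type*} [Fintype V] {G : SimpleGraph V} [DecidableRel G.Adj]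
    {c N : ℕ} [NeZero c] [NeZero N] {z : ZMod N → V} {u : ZMod c → V}
    (hz : IsLongestRing G Set.univ z) (hu : IsLongestRing G (Set.range z)ᶜ u) {δ : ℕ}
    (hδ : ∀ v, δ ≤ G.degree v) : (c + 1) * (δ + 1 - c) ≤ N := by
  classical
  rcases Nat.lt_or_ge δ c with hcδ | hcδ
  · simp [Nat.sub_eq_zero_of_le hcδ]
  set r := δ + 1 - c with hr
  obtain ⟨Q, hQ⟩ := exists_isMaximalExtension G (Set.range z)ᶜ u
  have hc := NeZero.pos c
  set A : ZMod N → Finset (ZMod c) := fun a => Finset.univ.filter fun i => G.Adj (tip u Q i) (z a)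
    with hA
  have hAmem : ∀ {i a}, i ∈ A a ↔ G.Adj (tip u Q i) (z a) := by simp [hA]
  set s : Finset (ZMod N) := Finset.univ.filter fun a => (A a).Nonempty with hs_def
  have hs : ∀ a, a ∈ s ↔ (A a).Nonempty := by simp [hs_def]
  obtain ⟨g, hg, hgN⟩ := exists_gap s
  set Y : ZMod c → Finset V := fun i =>
    (G.neighborFinset (tip u Q i)).filter fun y => y ∈ (Set.range z)ᶜ with hYdef
  have hY : ∀ i, ∀ y ∈ Y i, G.Adj (tip u Q i) y ∧ y ∈ (Set.range z)ᶜ := by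
    intro i y hy
    simpa [hYdef] using hy
  have hdeg : ∀ i, δ ≤ (Y i).card + (Finset.univ.filter fun a => i ∈ A a).card := by
    intro i
    have hsub : G.neighborFinset (tip u Q i) ⊆
        Y i ∪ (Finset.univ.filter fun a => i ∈ A a).image z := by
      intro y hy
      rw [Finset.mem_union, Finset.mem_image]
      by_cases hyz : y ∈ Set.range z
      · obtain ⟨a, rfl⟩ := hyz
        exact Or.inr ⟨a, by simpa [hA] using hy, rfl⟩
      · exact Or.inl (Finset.mem_filter.2 ⟨hy, hyz⟩)
    have h1 := (Finset.card_le_card hsub).trans (Finset.card_union_le _ _)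
    rw [G.card_neighborFinset_eq_degree] at h1
    have h2 := Finset.card_image_le (s := Finset.univ.filter fun a => i ∈ A a) (f := z)
    have := hδ (tip u Q i)
    omega
  have hlong : ∀ j, Q j ≠ [] → r ≤ (Finset.univ.filter fun a => j ∈ A a).card := by
    intro j hj
    have := (hQ.card_le_of_ne_nil hu hj (hY j)).1
    have := hdeg j
    omega
  have hnil : ∀ i, Q i = [] →
      r ≤ (Finset.univ.filter fun a => i ∈ A a).card + (feet G u Q i).card := by
    intro i hi
    have := hQ.card_le_of_eq_nil hi (hY i)
    have := hdeg i
    omega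
  have hfeet : ∀ i, ∀ j ∈ feet G u Q i, Q i = [] ∧ ¬ Q j = [] := by
    intro i j hj
    obtain ⟨h, y, t, hy, -⟩ := mem_feet.1 hj
    exact ⟨h, by simp [hy]⟩
  have hpos : ∀ j, 1 ≤ (Finset.univ.filter fun a => j ∈ A a).card → ∃ a, j ∈ A a := by
    intro j hj
    obtain ⟨a, ha⟩ := Finset.card_pos.1 hj
    exact ⟨a, (Finset.mem_filter.1 ha).2⟩
  have key := card_mul_add_le_sum_gap hs hg (feet := feet G u Q) (nil := fun i => Q i = [])
    (long := fun i => c ≤ 2 * (Q i).length + 2) (r := r) hfeet hlong ?_ hnil ?_ ?_ ?_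
  · rw [ZMod.card] at key
    exact key.trans hgN
  · intro j hj hshort
    have := (hQ.card_le_of_ne_nil hu hj (hY j)).2 (by omega)
    have := two_mul_card_feet_le hu hQ.toIsExtension hj
    have := hdeg j
    omega
  · intro j hj
    have h1 := two_mul_card_feet_le hu hQ.toIsExtension hj
    obtain ⟨l, hl⟩ : ∃ l, l ∉ insert j (Finset.univ.filter fun i => j ∈ feet G u Q i) := by
      by_contra! hcon
      have h2 := Finset.card_insert_le j (Finset.univ.filter fun i => j ∈ feet G u Q i)
      rw [Finset.eq_univ_of_forall hcon, Finset.card_univ, ZMod.card] at h2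
      omega
    simp only [Finset.mem_insert, Finset.mem_filter, Finset.mem_univ, true_and, not_or] at hl
    by_cases hQl : Q l = []
    · by_cases hfl : feet G u Q l = ∅
      · have := hnil l hQl
        rw [hfl, Finset.card_empty] at this
        exact ⟨l, hl.1, hpos l (by omega)⟩
      · obtain ⟨k, hk⟩ := Finset.nonempty_iff_ne_empty.2 hfl
        have := hlong k (hfeet l k hk).2
        exact ⟨k, by rintro rfl; exact hl.2 hk, hpos k (by omega)⟩
    · have := hlong l hQl
      exact ⟨l, hl.1, hpos l (by omega)⟩
  · intro a ha
    obtain ⟨h1, h2, h3, -⟩ := hg a ha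
    obtain ⟨j, hj⟩ := (hs _).1 h3
    exact hQ.card_lt_segment hz hu h1 h2 (fun i hi => hAmem.1 hi) ((hs a).1 ha) (hAmem.1 hj)
  · intro a ha j hj hjl hne
    rw [ZMod.card]
    obtain ⟨h1, h2, h3, -⟩ := hg a ha
    obtain ⟨i, k, hik, hi, hk, hjik⟩ : ∃ i k, i ≠ k ∧ i ∈ A a ∧ k ∈ A (a + g a) ∧
        (i = j ∨ k = j) := by
      by_cases h : ∃ k ∈ A (a + g a), k ≠ j
      · obtain ⟨k, hk, hkj⟩ := h
        exact ⟨j, k, hkj.symm, hj, hk, Or.inl rfl⟩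
      · push Not at h
        have h' : A (a + g a) = {j} := Finset.eq_singleton_iff_nonempty_unique_mem.2
          ⟨(hs _).1 h3, h⟩
        have h'' : ∃ i ∈ A a, i ≠ j := by
          by_contra! hcon
          exact hne ⟨Finset.eq_singleton_iff_unique_mem.2 ⟨hj, hcon⟩, h'⟩
        obtain ⟨i, hi, hij⟩ := h''
        exact ⟨i, j, hij, hi, by simp [h'], Or.inr rfl⟩
    obtain ⟨h4, h5⟩ := hQ.le_segment hz hu h1 h2 hik (hAmem.1 hi) (hAmem.1 hk)
    have hval : (k - i).val + (i - k).val = c := by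
      have hne' : k - i ≠ 0 := sub_ne_zero.2 hik.symm
      have : NeZero (k - i) := ⟨hne'⟩
      have := ZMod.val_neg_of_ne_zero (k - i)
      rw [neg_sub] at this
      have := ZMod.val_lt (k - i)
      omega
    rcases hjik with rfl | rfl <;> omega

/-- The vertices of a cycle, listed cyclically. -/
lemma SimpleGraph.Walk.IsCycle.exists_ring {V : Type*} {G : SimpleGraph V} {v : V} {C : G.Walk v v}
    (hC : C.IsCycle) : ∃ u : ZMod C.length → V, Function.Injective u ∧
      Set.range u = {x | x ∈ C.support} ∧ ∀ i, G.Adj (u i) (u (i + 1)) := by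
  have h3 := hC.three_le_length
  have : NeZero C.length := ⟨by omega⟩
  have : Fact (1 < C.length) := ⟨by omega⟩
  refine ⟨fun k => C.getVert k.val, fun i j h => ?_, ?_, fun i => ?_⟩
  · have hi := ZMod.val_lt i
    have hj := ZMod.val_lt j
    exact ZMod.val_injective _ (hC.getVert_injOn' (by simp; omega) (by simp; omega) h)
  · ext x
    rw [Set.mem_range]
    change _ ↔ x ∈ C.support
    constructor
    · rintro ⟨i, rfl⟩
      exact C.getVert_mem_support _
    · intro hx
      obtain ⟨n, hn, hle⟩ := Walk.mem_support_iff_exists_getVert.1 hx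
      rcases hle.lt_or_eq with h | rfl
      · exact ⟨n, by rw [ZMod.val_natCast_of_lt h, hn]⟩
      · exact ⟨0, by simpa using hn⟩
  · have hi := ZMod.val_lt i
    have hadj := C.adj_getVert_succ hi
    change G.Adj (C.getVert i.val) (C.getVert (i + 1).val)
    by_cases h : i.val + 1 < C.length
    · rwa [ZMod.val_add_of_lt (by rwa [ZMod.val_one]), ZMod.val_one]
    · have h' : i.val + 1 = C.length := by omega
      have h0 : (i + 1).val = 0 := by
        rw [ZMod.val_add, ZMod.val_one, h', Nat.mod_self]
      rw [h0]
      rw [h', C.getVert_length] at hadj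
      simpa using hadj

/-- A closed path with at least three vertices, given as a list, is a cycle. -/
lemma exists_isCycle_of_isChain {V : Type*} {G : SimpleGraph V} {x : V} {t : List V}
    (hn : (x :: t).Nodup) (hch : (x :: (t ++ [x])).IsChain G.Adj) (ht : 2 ≤ t.length) :
    ∃ C : G.Walk x x, C.IsCycle ∧ C.length = t.length + 1 := by
  classical
  have hmain : ∀ (l : List V) (a b : V), (a :: (l ++ [b])).IsChain G.Adj →
      ∃ p : G.Walk a b, p.support = a :: (l ++ [b]) := by
    intro l
    induction l with
    | nil =>
      intro a b h
      have h' : G.Adj a b := by simpa using h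
      exact ⟨h'.toWalk, by simp⟩
    | cons y l ih =>
      intro a b h
      rw [List.cons_append, List.isChain_cons_cons] at h
      obtain ⟨p, hp⟩ := ih y b h.2
      exact ⟨Walk.cons h.1 p, by simp [hp]⟩
  obtain ⟨p, hp⟩ := hmain t x x hch
  have hlen : p.length = t.length + 1 := by
    have := p.length_support
    rw [hp] at this
    simp at this
    omega
  refine ⟨p, ?_, hlen⟩
  rw [Walk.isCycle_iff_isPath_tail_and_le_length]
  refine ⟨?_, by omega⟩
  have hnil : ¬ p.Nil := by
    rw [← Walk.length_eq_zero_iff]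
    omega
  rw [Walk.isPath_def, Walk.support_tail_of_not_nil _ hnil, hp, List.tail_cons, List.nodup_append]
  rw [List.nodup_cons] at hn
  refine ⟨hn.2, by simp, ?_⟩
  rintro a ha b hb rfl
  rw [List.mem_singleton] at hb
  exact hn.1 (hb ▸ ha)

/-- A longest cycle is a longest ring. -/
lemma IsLongestCycle.exists_isLongestRing {V : Type*} {G : SimpleGraph V} {v : V} {C : G.Walk v v}
    (hC : IsLongestCycle G C) : ∃ z : ZMod C.length → V, IsLongestRing G Set.univ z ∧
      Set.range z = {x | x ∈ C.support} := by
  obtain ⟨z, hinj, hrange, hadj⟩ := hC.1.exists_ring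
  refine ⟨z, ⟨hinj, fun _ => Set.mem_univ _, fun i _ => hadj i, fun x t hn _ hch => ?_⟩, hrange⟩
  have h3 := hC.1.three_le_length
  by_cases ht : 2 ≤ t.length
  · obtain ⟨D, hD, hlen⟩ := exists_isCycle_of_isChain hn hch ht
    exact hlen ▸ hC.2 x D hD
  · omega

/-- The number `cbar` is realized by a longest ring. -/
lemma exists_isLongestRing_cbar {V : Type*} [Fintype V] (G : SimpleGraph V) {S : Set V}
    (hS : S.Nonempty) : 0 < cbar (G.induce S) ∧
      ∃ u : ZMod (cbar (G.induce S)) → V, IsLongestRing G S u := by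
  classical
  set H := G.induce S with hH
  set W := {n : ℕ | (n = 1 ∧ Nonempty S) ∨ (n = 2 ∧ ∃ u v : S, H.Adj u v) ∨
    ∃ (v : S) (c : H.Walk v v), c.IsCycle ∧ c.length = n} with hW
  have hbdd : BddAbove W := by
    refine ⟨Fintype.card S + 2, ?_⟩
    rintro n (⟨rfl, -⟩ | ⟨rfl, -⟩ | ⟨v, c, hc, rfl⟩)
    · omega
    · omega
    · have := hc.support_nodup.length_le_card
      rw [List.length_tail, Walk.length_support] at this
      omega
  have h1W : 1 ∈ W := Or.inl ⟨rfl, hS.to_subtype⟩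
  have hmem : cbar H ∈ W := Nat.sSup_mem ⟨1, h1W⟩ hbdd
  have hle : ∀ n ∈ W, n ≤ cbar H := fun n hn => le_csSup hbdd hn
  have hmax : ∀ (x : V) (t : List V), (x :: t).Nodup → (∀ y ∈ x :: t, y ∈ S) →
      (x :: (t ++ [x])).IsChain G.Adj → t.length + 1 ≤ cbar H := by
    intro x t hn hm hch
    obtain ⟨l, hl⟩ : ∃ l : List S, l.map Subtype.val = x :: t :=
      ⟨(x :: t).attachWith _ hm, by simp⟩
    obtain ⟨x', t', rfl⟩ : ∃ x' t', l = x' :: t' := by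
      cases l with
      | nil => simp at hl
      | cons x' t' => exact ⟨x', t', rfl⟩
    rw [List.map_cons, List.cons.injEq] at hl
    obtain ⟨rfl, rfl⟩ := hl
    have hn' : (x' :: t').Nodup := by
      rw [← List.map_cons] at hn
      exact hn.of_map _
    have hch' : (x' :: (t' ++ [x'])).IsChain H.Adj := by
      have : (x' :: (t' ++ [x'])).map Subtype.val =
          (x' : V) :: (t'.map Subtype.val ++ [(x' : V)]) := by simp
      rw [← this, List.isChain_map] at hch
      exact hch
    rw [List.length_map]
    match t', hn', hch' with
    | [], _, _ => exact hle 1 h1W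
    | [y], _, h => exact hle 2 (Or.inr (Or.inl ⟨rfl, x', y, by simpa using h.rel⟩))
    | a :: b :: t'', hn', hch' =>
      obtain ⟨D, hD, hlen⟩ := exists_isCycle_of_isChain hn' hch' (by simp)
      exact hle _ (Or.inr (Or.inr ⟨x', D, hD, hlen⟩))
  refine ⟨hle 1 h1W, ?_⟩
  clear_value H
  rcases hmem with ⟨h, -⟩ | ⟨h, a, b, hab⟩ | ⟨v, D, hD, h⟩
  · obtain ⟨x, hx⟩ := hS
    rw [h] at hmax ⊢
    exact ⟨fun _ => x, fun _ _ _ => Subsingleton.elim _ _, fun _ => hx,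
      fun _ h => absurd h (by omega), hmax⟩
  · subst hH
    rw [h] at hmax ⊢
    have hab' : G.Adj a b := hab
    refine ⟨fun i => if i = 0 then a else b, fun i j h => ?_, fun i => ?_, fun i _ => ?_, hmax⟩
    · have hne := hab'.ne
      by_cases hi : i = 0 <;> by_cases hj : j = 0 <;> simp [hi, hj, hne, hne.symm] at h ⊢
      revert hi hj
      revert i j
      decide
    · by_cases hi : i = 0 <;> simp [hi]
    · have : i = 0 ∨ i = 1 := by
        revert i
        decide
      rcases this with rfl | rfl
      · simpa using hab'
      · have h2 : (1 + 1 : ZMod 2) = 0 := rfl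
        simpa [h2] using hab'.symm
  · subst hH
    obtain ⟨u, hinj, -, hadj⟩ := hD.exists_ring
    rw [← h] at hmax ⊢
    exact ⟨fun i => u i, Subtype.val_injective.comp hinj, fun i => (u i).2,
      fun i _ => hadj i, hmax⟩

/-- If a longest cycle `C` is not a Hamilton cycle and `δ ≥ (n+2)/(l+1) + l - 2`,
then `(l - c̄)(δ - l - c̄ + 1) ≥ 1`. -/
theorem stmt_7 {V : Type*} [Fintype V] [DecidableEq V] (G : SimpleGraph V)
    [DecidableRel G.Adj] (l : ℕ) (hl : 1 ≤ l)
    {v : V} (C : G.Walk v v) (hC : IsLongestCycle G C)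
    (hnotHam : ¬ C.IsHamiltonianCycle)
    (hdeg : (G.minDegree : ℝ) ≥ ((Fintype.card V : ℝ) + 2) / ((l : ℝ) + 1) + (l : ℝ) - 2) :
    ((l : ℤ) - (cbar (G.induce {x : V | x ∉ C.support}) : ℤ)) *
      ((G.minDegree : ℤ) - (l : ℤ) - (cbar (G.induce {x : V | x ∉ C.support}) : ℤ) + 1)
      ≥ 1 := by
  obtain ⟨z, hz, hrange⟩ := hC.exists_isLongestRing
  have hcompl : {x : V | x ∉ C.support} = (Set.range z)ᶜ := by
    rw [hrange]
    rfl
  have h3 := hC.1.three_le_length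
  have : NeZero C.length := ⟨by omega⟩
  have hne : ((Set.range z)ᶜ).Nonempty := by
    rw [Set.nonempty_compl]
    intro h
    refine hnotHam (Walk.isHamiltonianCycle_iff_isCycle_and_length_eq.2 ⟨hC.1, ?_⟩)
    have := Fintype.card_of_bijective ⟨hz.injective, Set.range_eq_univ.1 h⟩
    rwa [ZMod.card] at this
  rw [hcompl]
  obtain ⟨hpos, u, hu⟩ := exists_isLongestRing_cbar G hne
  generalize cbar (G.induce (Set.range z)ᶜ) = c at *
  have : NeZero c := ⟨by omega⟩
  have hmul := hz.mul_le hu G.minDegree_le_degree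
  have hcard : C.length + c ≤ Fintype.card V := by
    have hinj : Function.Injective (Sum.elim z u) :=
      hz.injective.sumElim hu.injective fun i j h => hu.mem j ⟨i, h⟩
    have := Fintype.card_le_of_injective _ hinj
    rwa [Fintype.card_sum, ZMod.card, ZMod.card] at this
  generalize G.minDegree = δ at *
  have hdeg' : (Fintype.card V : ℤ) + 2 + ((l : ℤ) - 2) * (l + 1) ≤ δ * (l + 1) := by
    have hl' : (0 : ℝ) < (l : ℝ) + 1 := by positivity
    have : ((Fintype.card V : ℝ) + 2) / ((l : ℝ) + 1) ≤ δ - l + 2 := by linarith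
    rw [div_le_iff₀ hl'] at this
    have h : ((Fintype.card V : ℝ) + 2 + ((l : ℝ) - 2) * (l + 1)) ≤ δ * (l + 1) := by linarith
    exact_mod_cast h
  have hmul' : ((c : ℤ) + 1) * (δ + 1 - c) ≤ C.length := by
    rcases Nat.lt_or_ge δ c with h | h
    · have : ((c : ℤ) + 1) * (δ + 1 - c) ≤ 0 :=
        mul_nonpos_of_nonneg_of_nonpos (by omega) (by omega)
      omega
    · have h' : (c : ℤ) ≤ δ + 1 := by omega
      zify [show c ≤ δ + 1 by omega] at hmul
      exact hmul
  have hcard' : (C.length : ℤ) + c ≤ Fintype.card V := by exact_mod_cast hcard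
  linarith
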